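/- arXiv:1506.03883 — 2 statements merged into one kernel-verified Lean document; each statement's English description precedes it below -/
import Mathlib

section
/- It is decidable, given a finite game graph G, whether G yields static hierarchical information. -/
/-! Finitely-coded games: a concrete, `Primcodable` representation of finite game
graphs, used to state decidability results.  A coded game consists of: the number
of positions (positions are `0, …, numPos`, with initial position `0`), a finite
list of moves `(source, action profile, target)`, and an observation table whose
`i`-th row gives the observations of player `i` at each position (its length is
the number of players). -/

namespace CG

/-- A coded finite game graph: `(numPos, moves, obsTable)`. -/
abbrev Game : Type := ℕ × List (ℕ × List ℕ × ℕ) × List (List ℕ)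

def numPos (c : Game) : ℕ := c.1

def moves (c : Game) : List (ℕ × List ℕ × ℕ) := c.2.1

def obsTable (c : Game) : List (List ℕ) := c.2.2

/-- The number of players. -/
def numPlayers (c : Game) : ℕ := (obsTable c).length

/-- The observation of player `i` at position `v`. -/
def obsOf (c : Game) (i v : ℕ) : ℕ := ((obsTable c).getD i []).getD v 0

/-- The move relation, labelled by action profiles (coded as lists). -/
def Move (c : Game) (u : ℕ) (a : List ℕ) (w : ℕ) : Prop := (u, a, w) ∈ moves c

/-- Two positions are linked by a move for some action profile. -/
def Step (c : Game) (u w : ℕ) : Prop := ∃ a, Move c u a w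

/-- A history: a nonempty sequence of valid positions starting at the initial
position `0`, each consecutive pair lying on a move. -/
def IsHistory (c : Game) (π : List ℕ) : Prop :=
  π.head? = some 0 ∧ (∀ v ∈ π, v ≤ numPos c) ∧ π.Chain' (Step c)

/-- The observation sequence of player `i` along a history (the observation at
the initial position is discarded). -/
def obsSeq (c : Game) (i : ℕ) (π : List ℕ) : List ℕ := (π.drop 1).map (obsOf c i)

/-- Indistinguishability for player `i`. -/
def Indist (c : Game) (i : ℕ) (π π' : List ℕ) : Prop := obsSeq c i π = obsSeq c i π'

/-- The information set of player `i` at history `π`. -/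
def InfoSet (c : Game) (i : ℕ) (π : List ℕ) : Set (List ℕ) :=
  { π' | IsHistory c π' ∧ Indist c i π π' }

/-- The history `π` yields hierarchical information: the information sets of the
players are totally ordered by inclusion. -/
def HistHI (c : Game) (π : List ℕ) : Prop :=
  ∀ i < numPlayers c, ∀ j < numPlayers c,
    InfoSet c i π ⊆ InfoSet c j π ∨ InfoSet c j π ⊆ InfoSet c i π

/-- Static hierarchical information: there is a total order on the players such
that smaller players always have smaller information sets. -/
def StaticHI (c : Game) : Prop :=
  ∃ ord : ℕ → ℕ → Prop,
    (∀ i < numPlayers c, ord i i) ∧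
    (∀ i < numPlayers c, ∀ j < numPlayers c, ord i j ∨ ord j i) ∧
    (∀ i < numPlayers c, ∀ j < numPlayers c, ∀ k < numPlayers c,
      ord i j → ord j k → ord i k) ∧
    (∀ i < numPlayers c, ∀ j < numPlayers c, ord i j → ord j i → i = j) ∧
    (∀ i < numPlayers c, ∀ j < numPlayers c, ord i j →
      ∀ π, IsHistory c π → InfoSet c i π ⊆ InfoSet c j π)

/-- Dynamic hierarchical information: every history yields hierarchical information. -/
def DynamicHI (c : Game) : Prop := ∀ π, IsHistory c π → HistHI c π

/-- The prefix `v₀ … v_t` of a play, as a list. -/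
def playPrefix (f : ℕ → ℕ) (t : ℕ) : List ℕ := (List.range (t + 1)).map f

/-- A play: an infinite sequence all of whose prefixes are histories. -/
def IsPlay (c : Game) (f : ℕ → ℕ) : Prop := ∀ t, IsHistory c (playPrefix f t)

/-- Recurring hierarchical information: along every play, infinitely many prefix
histories yield hierarchical information. -/
def RecurringHI (c : Game) : Prop :=
  ∀ f, IsPlay c f → ∀ T, ∃ t, T ≤ t ∧ HistHI c (playPrefix f t)

/-- Information-consistency of a strategy of player `i`. -/
def Consistent (c : Game) (i : ℕ) (s : List ℕ → ℕ) : Prop :=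
  ∀ π π', IsHistory c π → IsHistory c π' → Indist c i π π' → s π = s π'

/-- A play follows a strategy profile `s`: at each round some move is taken whose
action profile agrees with the actions prescribed by `s` for every player. -/
def Follows (c : Game) (s : ℕ → List ℕ → ℕ) (f : ℕ → ℕ) : Prop :=
  IsPlay c f ∧ ∀ t, ∃ a, Move c (f t) a (f (t + 1)) ∧
    ∀ i < numPlayers c, a.getD i 0 = s i (playPrefix f t)

/-- A history follows a strategy profile `s`. -/
def HFollows (c : Game) (s : ℕ → List ℕ → ℕ) (π : List ℕ) : Prop :=
  IsHistory c π ∧ ∀ k, k + 1 < π.length →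
    ∃ a, Move c (π.getD k 0) a (π.getD (k + 1) 0) ∧
      ∀ i < numPlayers c, a.getD i 0 = s i (π.take (k + 1))

/-- A coded deterministic parity automaton over alphabet `ℕ`:
`(transition table ((state, letter), target), priorities)`; initial state `0`;
missing transitions default to state `0`. -/
abbrev DPA : Type := List ((ℕ × ℕ) × ℕ) × List ℕ

/-- The transition function of a coded parity automaton. -/
def dpaStep (d : DPA) (q v : ℕ) : ℕ :=
  ((d.1.find? fun e => e.1.1 == q && e.1.2 == v).map Prod.snd).getD 0

/-- The run of a coded parity automaton on an infinite word. -/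
def dpaRun (d : DPA) (f : ℕ → ℕ) : ℕ → ℕ
  | 0 => 0
  | t + 1 => dpaStep d (dpaRun d f t) (f t)

/-- The priority of a state. -/
def prio (d : DPA) (q : ℕ) : ℕ := d.2.getD q 0

/-- Parity acceptance: the least priority occurring infinitely often in the run is even. -/
def Accepts (d : DPA) (f : ℕ → ℕ) : Prop :=
  Even (sInf { p | ∃ᶠ t in Filter.atTop, prio d (dpaRun d f t) = p })

/-- A distributed winning strategy for the ω-regular winning condition given by
the parity automaton `d` over the positions. -/
def WinningProfile (c : Game) (d : DPA) (s : ℕ → List ℕ → ℕ) : Prop :=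
  (∀ i < numPlayers c, Consistent c i (s i)) ∧ ∀ f, Follows c s f → Accepts d f

/-- The game admits a distributed winning strategy. -/
def HasDWS (c : Game) (d : DPA) : Prop := ∃ s, WinningProfile c d s

/-- A Moore machine with finite state set `Q`, input alphabet `σ`, output alphabet `γ`. -/
structure Moore (σ γ : Type) where
  Q : Type
  finQ : Fintype Q
  q0 : Q
  δ : Q → σ → Q
  out : Q → γ

/-- The output letter of a Moore machine after reading a word. -/
def Moore.output {σ γ : Type} (mc : Moore σ γ) (w : List σ) : γ :=
  mc.out (w.foldl mc.δ mc.q0)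

/-- A finite-state strategy for player `i`: implemented by a Moore machine reading
the observation sequence of the history. -/
def FinStateStrategy (c : Game) (i : ℕ) (s : List ℕ → ℕ) : Prop :=
  ∃ mc : Moore ℕ ℕ, ∀ π, IsHistory c π → s π = mc.output (obsSeq c i π)

/-- The game admits a finite-state distributed winning strategy. -/
def HasFinDWS (c : Game) (d : DPA) : Prop :=
  ∃ s, WinningProfile c d s ∧ ∀ i < numPlayers c, FinStateStrategy c i (s i)

/-- The colour of position `v` under a coded colouring. -/
def colOf (γ : List ℕ) (v : ℕ) : ℕ := γ.getD v 0

/-- The colouring `γ` is observable: each player's observation distinguishes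
positions of different colours. -/
def Observable (c : Game) (γ : List ℕ) : Prop :=
  ∀ i < numPlayers c, ∀ v ≤ numPos c, ∀ w ≤ numPos c,
    colOf γ v ≠ colOf γ w → obsOf c i v ≠ obsOf c i w

/-- A distributed winning strategy for the winning condition over colours given
by the colouring `γ` and the parity automaton `d` over colours. -/
def WinningProfileCol (c : Game) (γ : List ℕ) (d : DPA) (s : ℕ → List ℕ → ℕ) : Prop :=
  (∀ i < numPlayers c, Consistent c i (s i)) ∧
    ∀ f, Follows c s f → Accepts d fun t => colOf γ (f t)

/-- The game admits a distributed winning strategy (colour version). -/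
def HasDWSCol (c : Game) (γ : List ℕ) (d : DPA) : Prop := ∃ s, WinningProfileCol c γ d s

/-- The game admits a finite-state distributed winning strategy (colour version). -/
def HasFinDWSCol (c : Game) (γ : List ℕ) (d : DPA) : Prop :=
  ∃ s, WinningProfileCol c γ d s ∧ ∀ i < numPlayers c, FinStateStrategy c i (s i)

/-- The strategy profile `s` maintains hierarchical information: every history
that follows `s` yields hierarchical information. -/
def Maintains (c : Game) (s : ℕ → List ℕ → ℕ) : Prop :=
  ∀ π, HFollows c s π → HistHI c π

end CG

namespace CG

/-- Joint steps of two histories that player `i` cannot tell apart. -/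
def PairStep (c : Game) (i : ℕ) (x y : ℕ × ℕ) : Prop :=
  Step c x.1 y.1 ∧ Step c x.2 y.2 ∧ y.1 ≤ numPos c ∧ y.2 ≤ numPos c ∧
    obsOf c i y.1 = obsOf c i y.2

/-- Pairs of positions reached by two histories that player `i` cannot tell apart. -/
def PairReach (c : Game) (i : ℕ) : ℕ × ℕ → Prop :=
  Relation.ReflTransGen (PairStep c i) (0, 0)

/-- Player `i` is always at least as well informed as player `j`. -/
def Finer (c : Game) (i j : ℕ) : Prop :=
  ∀ π, IsHistory c π → InfoSet c i π ⊆ InfoSet c j π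

theorem Finer.trans {c : Game} {i j k : ℕ} (h₁ : Finer c i j) (h₂ : Finer c j k) :
    Finer c i k := fun π hπ => (h₁ π hπ).trans (h₂ π hπ)

/-- A total preorder on the players can be refined to a total order. -/
theorem staticHI_iff_finer_total (c : Game) :
    StaticHI c ↔ ∀ i < numPlayers c, ∀ j < numPlayers c, Finer c i j ∨ Finer c j i := by
  constructor
  · rintro ⟨ord, -, htot, -, -, hsub⟩ i hi j hj
    exact (htot i hi j hj).imp (hsub i hi j hj) (hsub j hj i hi)
  · intro h
    refine ⟨fun i j => Finer c i j ∧ (Finer c j i → i ≤ j), ?_, ?_, ?_, ?_, ?_⟩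
    · exact fun i _ => ⟨fun _ _ => subset_rfl, fun _ => le_rfl⟩
    · intro i hi j hj
      have := h i hi j hj
      have := le_total i j
      tauto
    · rintro i - j - k - ⟨hij, hij'⟩ ⟨hjk, hjk'⟩
      exact ⟨hij.trans hjk, fun hki => (hij' (hjk.trans hki)).trans (hjk' (hki.trans hij))⟩
    · rintro i - j - ⟨hij, hij'⟩ ⟨hji, hji'⟩
      exact le_antisymm (hij' hji) (hji' hij)
    · exact fun i _ j _ hij => hij.1

/-- If every jointly reachable pair looks the same to player `j`, then so do the continuations
of two `i`-indistinguishable histories. -/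
theorem map_obsOf_eq_of_pairReach {c : Game} {i j : ℕ}
    (h : ∀ x, PairReach c i x → obsOf c j x.1 = obsOf c j x.2) (l : List ℕ) :
    ∀ (l' : List ℕ) (u u' : ℕ), PairReach c i (u, u') →
      (u :: l).IsChain (Step c) → (u' :: l').IsChain (Step c) →
      (∀ v ∈ l, v ≤ numPos c) → (∀ v ∈ l', v ≤ numPos c) →
      l.map (obsOf c i) = l'.map (obsOf c i) → l.map (obsOf c j) = l'.map (obsOf c j) := by
  induction l with
  | nil => intro l' u u' _ _ _ _ _ he; simp_all
  | cons v l ih =>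
    rintro (_ | ⟨v', l'⟩) u u' hr hc hc' hb hb' he
    · simp at he
    · rw [List.isChain_cons_cons] at hc hc'
      simp only [List.map_cons, List.cons.injEq, List.forall_mem_cons] at he hb hb' ⊢
      have hv : PairReach c i (v, v') :=
        Relation.ReflTransGen.tail hr ⟨hc.1, hc'.1, hb.1, hb'.1, he.1⟩
      exact ⟨h _ hv, ih l' v v' hv hc.2 hc'.2 hb.2 hb'.2 he.2⟩

/-- If `j` distinguishes no two `i`-indistinguishable continuations from a pair, it does not
distinguish the members of any pair jointly reachable from there. -/
theorem obsOf_eq_of_reflTransGen {c : Game} {i j : ℕ} {x y : ℕ × ℕ}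
    (hxy : Relation.ReflTransGen (PairStep c i) x y)
    (hx : obsOf c j x.1 = obsOf c j x.2)
    (h : ∀ l l' : List ℕ, (x.1 :: l).IsChain (Step c) → (x.2 :: l').IsChain (Step c) →
      (∀ v ∈ l, v ≤ numPos c) → (∀ v ∈ l', v ≤ numPos c) →
      l.map (obsOf c i) = l'.map (obsOf c i) → l.map (obsOf c j) = l'.map (obsOf c j)) :
    obsOf c j y.1 = obsOf c j y.2 := by
  induction hxy using Relation.ReflTransGen.head_induction_on with
  | refl => exact hx
  | @head x z hxz _ ih =>
    obtain ⟨h₁, h₂, hb₁, hb₂, ho⟩ := hxz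
    have key : ∀ l l' : List ℕ, (z.1 :: l).IsChain (Step c) → (z.2 :: l').IsChain (Step c) →
        (∀ v ∈ l, v ≤ numPos c) → (∀ v ∈ l', v ≤ numPos c) →
        l.map (obsOf c i) = l'.map (obsOf c i) →
        (z.1 :: l).map (obsOf c j) = (z.2 :: l').map (obsOf c j) := by
      intro l l' hc hc' hb hb' he
      exact h (z.1 :: l) (z.2 :: l') (hc.cons_cons h₁) (hc'.cons_cons h₂)
        (List.forall_mem_cons.2 ⟨hb₁, hb⟩) (List.forall_mem_cons.2 ⟨hb₂, hb'⟩) (by simp [ho, he])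
    refine ih ?_ ?_
    · simpa using key [] [] (by simp) (by simp) (by simp) (by simp) rfl
    · intro l l' hc hc' hb hb' he
      have := key l l' hc hc' hb hb' he
      simp only [List.map_cons, List.cons.injEq] at this
      exact this.2

theorem isHistory_iff (c : Game) (π : List ℕ) :
    IsHistory c π ↔
      ∃ l, π = 0 :: l ∧ (0 :: l).IsChain (Step c) ∧ ∀ v ∈ l, v ≤ numPos c := by
  cases π with
  | nil => simp [IsHistory]
  | cons a l =>
    constructor
    · rintro ⟨h0, hb, hc⟩
      obtain rfl : a = 0 := by simpa using h0
      exact ⟨l, rfl, hc, fun v hv => hb v (List.mem_cons_of_mem _ hv)⟩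
    · rintro ⟨l', he, hc, hb⟩
      obtain ⟨rfl, rfl⟩ := List.cons.inj he
      exact ⟨rfl, List.forall_mem_cons.2 ⟨Nat.zero_le _, hb⟩, hc⟩

theorem finer_iff_pairReach (c : Game) (i j : ℕ) :
    Finer c i j ↔ ∀ x, PairReach c i x → obsOf c j x.1 = obsOf c j x.2 := by
  constructor
  · intro h x hx
    refine obsOf_eq_of_reflTransGen hx rfl fun l l' hc hc' hb hb' he => ?_
    have h₁ : IsHistory c (0 :: l) := (isHistory_iff _ _).2 ⟨l, rfl, hc, hb⟩
    have h₂ : IsHistory c (0 :: l') := (isHistory_iff _ _).2 ⟨l', rfl, hc', hb'⟩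
    exact (h _ h₁ ⟨h₂, he⟩).2
  · rintro h π hπ π' ⟨hπ', he⟩
    refine ⟨hπ', ?_⟩
    obtain ⟨l, rfl, hc, hb⟩ := (isHistory_iff _ _).1 hπ
    obtain ⟨l', rfl, hc', hb'⟩ := (isHistory_iff _ _).1 hπ'
    exact map_obsOf_eq_of_pairReach h l l' 0 0 .refl hc hc' hb hb' he

/-- The joint step condition along two given moves. -/
def JointMove (c : Game) (i : ℕ) (x : ℕ × ℕ) (m m' : ℕ × List ℕ × ℕ) : Prop :=
  m.1 = x.1 ∧ m'.1 = x.2 ∧ m.2.2 ≤ numPos c ∧ m'.2.2 ≤ numPos c ∧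
    obsOf c i m.2.2 = obsOf c i m'.2.2

instance (c : Game) (i : ℕ) (x : ℕ × ℕ) (m m' : ℕ × List ℕ × ℕ) :
    Decidable (JointMove c i x m m') := by
  unfold JointMove; infer_instance

/-- The list of joint successors of a pair of positions. -/
def pairSuccs (c : Game) (i : ℕ) (x : ℕ × ℕ) : List (ℕ × ℕ) :=
  (moves c).flatMap fun m => (moves c).flatMap fun m' =>
    if JointMove c i x m m' then [(m.2.2, m'.2.2)] else []

theorem mem_pairSuccs {c : Game} {i : ℕ} {x y : ℕ × ℕ} :
    y ∈ pairSuccs c i x ↔ PairStep c i x y := by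
  simp only [pairSuccs, List.mem_flatMap]
  constructor
  · rintro ⟨⟨u, a, w⟩, hm, ⟨u', a', w'⟩, hm', hy⟩
    split_ifs at hy with h
    · obtain ⟨rfl, rfl, hb, hb', ho⟩ := h
      obtain rfl : y = (w, w') := by simpa using hy
      exact ⟨⟨a, hm⟩, ⟨a', hm'⟩, hb, hb', ho⟩
    · simp at hy
  · rintro ⟨⟨a, hm⟩, ⟨a', hm'⟩, hb, hb', ho⟩
    refine ⟨_, hm, _, hm', ?_⟩
    rw [if_pos ⟨rfl, rfl, hb, hb', ho⟩]
    simp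

/-- Pairs jointly reachable within `k` steps. -/
def reachList (c : Game) (i k : ℕ) : List (ℕ × ℕ) :=
  (fun L => L ++ L.flatMap (pairSuccs c i))^[k] [(0, 0)]

theorem reachList_succ (c : Game) (i k : ℕ) :
    reachList c i (k + 1) = reachList c i k ++ (reachList c i k).flatMap (pairSuccs c i) := by
  rw [reachList, Function.iterate_succ_apply']; rfl

theorem reachList_mono (c : Game) (i : ℕ) {k l : ℕ} (h : k ≤ l) :
    reachList c i k ⊆ reachList c i l := by
  induction h with
  | refl => exact List.Subset.refl _
  | step _ ih => rw [reachList_succ]; exact List.Subset.trans ih (List.subset_append_left _ _)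

theorem pairReach_of_mem_reachList {c : Game} {i k : ℕ} {x : ℕ × ℕ} (h : x ∈ reachList c i k) :
    PairReach c i x := by
  induction k generalizing x with
  | zero =>
    obtain rfl : x = (0, 0) := by simpa [reachList] using h
    exact .refl
  | succ k ih =>
    rw [reachList_succ, List.mem_append, List.mem_flatMap] at h
    rcases h with h | ⟨y, hy, hx⟩
    · exact ih h
    · exact .tail (ih hy) (mem_pairSuccs.1 hx)

theorem exists_mem_reachList {c : Game} {i : ℕ} {x : ℕ × ℕ} (h : PairReach c i x) :
    ∃ k, x ∈ reachList c i k := by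
  induction h with
  | refl => exact ⟨0, by simp [reachList]⟩
  | tail _ hs ih =>
    obtain ⟨k, hk⟩ := ih
    refine ⟨k + 1, ?_⟩
    rw [reachList_succ, List.mem_append, List.mem_flatMap]
    exact .inr ⟨_, hk, mem_pairSuccs.2 hs⟩

theorem PairReach.le_numPos {c : Game} {i : ℕ} {x : ℕ × ℕ} (h : PairReach c i x) :
    x.1 ≤ numPos c ∧ x.2 ≤ numPos c := by
  cases h with
  | refl => exact ⟨Nat.zero_le _, Nat.zero_le _⟩
  | tail _ hs => exact ⟨hs.2.2.1, hs.2.2.2.1⟩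

/-- The exploration has reached a fixed point for every player after `k` rounds. -/
def Saturated (c : Game) (k : ℕ) : Prop :=
  ∀ i < numPlayers c, ∀ x ∈ reachList c i (k + 1), x ∈ reachList c i k

theorem Saturated.mem_reachList {c : Game} {k : ℕ} (hk : Saturated c k) {i : ℕ}
    (hi : i < numPlayers c) {x : ℕ × ℕ} : x ∈ reachList c i k ↔ PairReach c i x := by
  refine ⟨pairReach_of_mem_reachList, fun h => ?_⟩
  induction h with
  | refl => exact reachList_mono c i (Nat.zero_le k) (by simp [reachList])
  | tail _ hs ih =>
    refine hk i hi _ ?_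
    rw [reachList_succ, List.mem_append, List.mem_flatMap]
    exact .inr ⟨_, ih, mem_pairSuccs.2 hs⟩

theorem exists_saturated (c : Game) : ∃ k, Saturated c k := by
  have hfin : {p : ℕ × ℕ × ℕ | p.1 < numPlayers c ∧ PairReach c p.1 p.2}.Finite := by
    refine ((Set.finite_Iio (numPlayers c)).prod
      ((Set.finite_Iic (numPos c)).prod (Set.finite_Iic (numPos c)))).subset ?_
    exact fun p hp => ⟨hp.1, hp.2.le_numPos⟩
  choose! f hf using fun (p : ℕ × ℕ × ℕ) (h : PairReach c p.1 p.2) => exists_mem_reachList h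
  obtain ⟨k, hk⟩ := (hfin.image f).bddAbove
  refine ⟨k, fun i hi x hx => ?_⟩
  have hr := pairReach_of_mem_reachList hx
  exact reachList_mono c i (hk ⟨(i, x), ⟨hi, hr⟩, rfl⟩) (hf (i, x) hr)

/-- The comparability of all players, tested on the pairs found within `k` rounds. -/
def ComparableWithin (c : Game) (k : ℕ) : Prop :=
  ∀ i < numPlayers c, ∀ j < numPlayers c,
    (∀ x ∈ reachList c i k, obsOf c j x.1 = obsOf c j x.2) ∨
      ∀ x ∈ reachList c j k, obsOf c i x.1 = obsOf c i x.2

theorem Saturated.comparableWithin_iff {c : Game} {k : ℕ} (hk : Saturated c k) :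
    ComparableWithin c k ↔ StaticHI c := by
  rw [staticHI_iff_finer_total]
  refine forall₂_congr fun i hi => forall₂_congr fun j hj => ?_
  simp only [hk.mem_reachList hi, hk.mem_reachList hj, finer_iff_pairReach]

section Primrec

open Primrec

variable {α : Type*} [Primcodable α]

theorem primrec_numPos : Primrec numPos := fst

theorem primrec_moves : Primrec moves := fst.comp snd

theorem primrec_numPlayers : Primrec numPlayers := list_length.comp (snd.comp snd)

theorem primrec_obsOf {f : α → Game} {g h : α → ℕ} (hf : Primrec f) (hg : Primrec g)
    (hh : Primrec h) : Primrec fun a => obsOf (f a) (g a) (h a) :=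
  (list_getD 0).comp ((list_getD []).comp (snd.comp (snd.comp hf)) hg) hh

theorem primrec_pairSuccs {f : α → Game} {g : α → ℕ} {h : α → ℕ × ℕ} (hf : Primrec f)
    (hg : Primrec g) (hh : Primrec h) : Primrec fun a => pairSuccs (f a) (g a) (h a) := by
  have hm : Primrec fun p : (α × (ℕ × List ℕ × ℕ)) × (ℕ × List ℕ × ℕ) => p.1.2 := snd.comp fst
  have ht := snd.comp (snd.comp hm)
  have ht' : Primrec fun p : (α × (ℕ × List ℕ × ℕ)) × (ℕ × List ℕ × ℕ) => p.2.2.2 :=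
    snd.comp (snd.comp snd)
  have ha : Primrec fun p : (α × (ℕ × List ℕ × ℕ)) × (ℕ × List ℕ × ℕ) => p.1.1 := fst.comp fst
  have hn := primrec_numPos.comp (hf.comp ha)
  have hcond : PrimrecPred fun p : (α × (ℕ × List ℕ × ℕ)) × (ℕ × List ℕ × ℕ) =>
      JointMove (f p.1.1) (g p.1.1) (h p.1.1) p.1.2 p.2 :=
    (Primrec.eq.comp (fst.comp hm) (fst.comp (hh.comp ha))).and <|
      (Primrec.eq.comp (fst.comp snd) (snd.comp (hh.comp ha))).and <|
      (nat_le.comp ht hn).and <| (nat_le.comp ht' hn).and <|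
      Primrec.eq.comp (primrec_obsOf (hf.comp ha) (hg.comp ha) ht)
        (primrec_obsOf (hf.comp ha) (hg.comp ha) ht')
  have hite := Primrec.ite hcond (list_cons.comp (Primrec.pair ht ht') (const [])) (const [])
  exact list_flatMap (primrec_moves.comp hf)
    (list_flatMap (primrec_moves.comp (hf.comp fst)) hite.to₂).to₂

theorem primrec_reachList {f : α → Game} {g k : α → ℕ} (hf : Primrec f) (hg : Primrec g)
    (hk : Primrec k) : Primrec fun a => reachList (f a) (g a) (k a) := by
  have hsuccs : Primrec₂ fun (p : α × List (ℕ × ℕ)) (x : ℕ × ℕ) =>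
      pairSuccs (f p.1) (g p.1) x :=
    primrec_pairSuccs (hf.comp (fst.comp fst)) (hg.comp (fst.comp fst)) snd
  exact nat_iterate hk (const [(0, 0)]) (list_append.comp snd (list_flatMap snd hsuccs)).to₂

/-- A bounded universal quantifier over the players, with parameters. -/
theorem primrecPred_forall_player {f : α → Game} (hf : Primrec f) {p : ℕ → α → Prop}
    (hp : PrimrecRel p) : PrimrecPred fun a => ∀ i < numPlayers (f a), p i a :=
  (hp.forall_mem_list.comp (list_range.comp (primrec_numPlayers.comp hf)) .id).of_eq (by simp)

theorem primrecPred_saturated : PrimrecPred fun p : Game × ℕ => Saturated p.1 p.2 := by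
  refine primrecPred_forall_player fst ?_
  have hmem : PrimrecRel fun (x : ℕ × ℕ) (L : List (ℕ × ℕ)) => ∃ y ∈ L, y = x :=
    Primrec.eq.exists_mem_list.comp snd fst
  have hsub := hmem.forall_mem_list
  have hc : Primrec fun q : ℕ × Game × ℕ => q.2.1 := fst.comp snd
  have hk : Primrec fun q : ℕ × Game × ℕ => q.2.2 := snd.comp snd
  exact (hsub.comp (primrec_reachList hc fst (Primrec.succ.comp hk))
    (primrec_reachList hc fst hk)).of_eq fun q => by simp

theorem primrecPred_comparableWithin :
    PrimrecPred fun p : Game × ℕ => ComparableWithin p.1 p.2 := by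
  have hobs : PrimrecRel fun (x : ℕ × ℕ) (q : Game × ℕ) =>
      obsOf q.1 q.2 x.1 = obsOf q.1 q.2 x.2 :=
    Primrec.eq.comp (primrec_obsOf (fst.comp snd) (snd.comp snd) (fst.comp fst))
      (primrec_obsOf (fst.comp snd) (snd.comp snd) (snd.comp fst))
  have hall := hobs.forall_mem_list
  refine primrecPred_forall_player fst ?_
  refine primrecPred_forall_player (fst.comp snd) (p := fun j (q : ℕ × Game × ℕ) => _) ?_
  have hi : Primrec fun q : ℕ × ℕ × Game × ℕ => q.2.1 := fst.comp snd
  have hc : Primrec fun q : ℕ × ℕ × Game × ℕ => q.2.2.1 := fst.comp (snd.comp snd)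
  have hk : Primrec fun q : ℕ × ℕ × Game × ℕ => q.2.2.2 := snd.comp (snd.comp snd)
  exact (hall.comp (primrec_reachList hc hi hk) (Primrec.pair hc fst)).or
    (hall.comp (primrec_reachList hc fst hk) (Primrec.pair hc hi))

end Primrec

end CG

/-- It is decidable, given a finite game graph, whether it yields static
hierarchical information. -/
theorem statement3 : ComputablePred (fun c : CG.Game => CG.StaticHI c) := by
  classical
  have hfind := Computable.find (P := CG.Saturated)
    CG.primrecPred_saturated.computablePred CG.exists_saturated
  have hdec := CG.primrecPred_comparableWithin.decide.to_comp.comp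
    (Computable.pair Computable.id hfind)
  exact hdec.computablePred.of_eq fun c =>
    (Nat.find_spec (CG.exists_saturated c)).comparableWithin_iff
end

section
/- For every finite game G with dynamic hierarchical information and ω-regular winning condition W, there exists a finite game G' with dynamic hierarchical information and ω-regular winning condition W' such that G' is cross-free (no two players cross at any stage of any play) and such that G admits a distributed winning strategy if and only if G' does, and G admits a finite-state distributed winning strategy if and only if G' does. -/
/-- A finite game graph for `n` players: positions `V` with initial position `init`,
action sets `A i`, observation sets `B i`, a move relation labelled by action
profiles (with no dead ends), and observation functions. -/
structure GameGraph (n : ℕ) (V : Type) (A : Fin n → Type) (B : Fin n → Type) where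
  init : V
  move : V → (∀ i, A i) → V → Prop
  noDeadEnd : ∀ v a, ∃ w, move v a w
  obs : ∀ i : Fin n, V → B i

/-- A Moore machine with finite state set `Q`, input alphabet `σ`, output alphabet `γ`. -/
structure Moore (σ γ : Type) where
  Q : Type
  finQ : Fintype Q
  q0 : Q
  δ : Q → σ → Q
  out : Q → γ

namespace Moore

/-- The output letter of a Moore machine after reading a word. -/
def output {σ γ : Type} (mc : Moore σ γ) (w : List σ) : γ :=
  mc.out (w.foldl mc.δ mc.q0)

/-- The output word of a Moore machine along a word: the `k`-th letter is the
output after reading the prefix of length `k+1`. -/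
def outWord {σ γ : Type} (mc : Moore σ γ) (w : List σ) : List γ :=
  ((w.scanl mc.δ mc.q0).drop 1).map mc.out

end Moore

/-- A deterministic parity automaton over alphabet `α`. -/
structure ParityAut (α : Type) where
  Q : Type
  finQ : Fintype Q
  q0 : Q
  δ : Q → α → Q
  prio : Q → ℕ

namespace ParityAut

/-- The run of a deterministic parity automaton on an infinite word. -/
def run {α : Type} (d : ParityAut α) (f : ℕ → α) : ℕ → d.Q
  | 0 => d.q0
  | t + 1 => d.δ (run d f t) (f t)

/-- Parity acceptance: the least priority occurring infinitely often is even. -/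
def Accepts {α : Type} (d : ParityAut α) (f : ℕ → α) : Prop :=
  Even (sInf { p | ∃ᶠ t in Filter.atTop, d.prio (d.run f t) = p })

end ParityAut

/-- A deterministic Büchi automaton over alphabet `α` with state set `σ`. -/
structure DetBuchi (α σ : Type) where
  q0 : σ
  δ : σ → α → σ
  accept : Set σ

namespace DetBuchi

/-- The run of a deterministic Büchi automaton on an infinite word. -/
def run {α σ : Type} (d : DetBuchi α σ) (f : ℕ → α) : ℕ → σ
  | 0 => d.q0
  | t + 1 => d.δ (run d f t) (f t)

/-- Büchi acceptance: the run visits accepting states infinitely often. -/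
def Accepts {α σ : Type} (d : DetBuchi α σ) (f : ℕ → α) : Prop :=
  ∃ᶠ t in Filter.atTop, d.run f t ∈ d.accept

end DetBuchi

namespace GameGraph

variable {n : ℕ} {V : Type} {A B : Fin n → Type}

/-- Two positions are linked by a move (for some action profile). -/
def step (G : GameGraph n V A B) (u w : V) : Prop := ∃ a, G.move u a w

/-- A history: a nonempty sequence starting at the initial position, each
consecutive pair lying on a move. -/
def IsHistory (G : GameGraph n V A B) (π : List V) : Prop :=
  π.head? = some G.init ∧ π.Chain' G.step

/-- The observation sequence of player `i` along a history (the observation at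
the initial position is discarded). -/
def obsSeq (G : GameGraph n V A B) (i : Fin n) (π : List V) : List (B i) :=
  (π.drop 1).map (G.obs i)

/-- Histories are indistinguishable for player `i` if they yield the same observations. -/
def Indist (G : GameGraph n V A B) (i : Fin n) (π π' : List V) : Prop :=
  G.obsSeq i π = G.obsSeq i π'

/-- The information set of player `i` at history `π`. -/
def InfoSet (G : GameGraph n V A B) (i : Fin n) (π : List V) : Set (List V) :=
  { π' | G.IsHistory π' ∧ G.Indist i π π' }

/-- A history yields hierarchical information if the information sets of players
are totally ordered by inclusion. -/
def HistHI (G : GameGraph n V A B) (π : List V) : Prop :=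
  ∀ i j : Fin n, G.InfoSet i π ⊆ G.InfoSet j π ∨ G.InfoSet j π ⊆ G.InfoSet i π

/-- Static hierarchical information: there is a total order of the players such
that along every history, the information sets respect this order. -/
def StaticHI (G : GameGraph n V A B) : Prop :=
  ∃ ord : Fin n → Fin n → Prop, IsLinearOrder (Fin n) ord ∧
    ∀ i j : Fin n, ord i j → ∀ π, G.IsHistory π → G.InfoSet i π ⊆ G.InfoSet j π

/-- Hierarchical observation: there is a total order of the players such that
the observation of a smaller player determines that of a bigger player, positionally. -/
def HierObs (G : GameGraph n V A B) : Prop :=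
  ∃ ord : Fin n → Fin n → Prop, IsLinearOrder (Fin n) ord ∧
    ∀ i j : Fin n, ord i j → ∀ v v' : V, G.obs i v = G.obs i v' → G.obs j v = G.obs j v'

/-- Dynamic hierarchical information: every history yields hierarchical information. -/
def DynamicHI (G : GameGraph n V A B) : Prop := ∀ π, G.IsHistory π → G.HistHI π

/-- The prefix `v₀ … v_t` of a play, as a list. -/
def playPrefix (f : ℕ → V) (t : ℕ) : List V := (List.range (t + 1)).map f

/-- A play: an infinite sequence all of whose prefixes are histories. -/
def IsPlay (G : GameGraph n V A B) (f : ℕ → V) : Prop :=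
  ∀ t, G.IsHistory (playPrefix f t)

/-- A play yields recurring hierarchical information if infinitely many of its
prefix histories yield hierarchical information. -/
def PlayRecurringHI (G : GameGraph n V A B) (f : ℕ → V) : Prop :=
  ∀ T, ∃ t, T ≤ t ∧ G.HistHI (playPrefix f t)

/-- A game yields recurring hierarchical information if every play does. -/
def RecurringHI (G : GameGraph n V A B) : Prop :=
  ∀ f, G.IsPlay f → G.PlayRecurringHI f

/-- `[t, t+ℓ]` is a gap of the play `f`: no prefix of length `r ∈ [t, t+ℓ]` yields
hierarchical information.  The length of this gap is `ℓ + 1`. -/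
def IsGap (G : GameGraph n V A B) (f : ℕ → V) (t ℓ : ℕ) : Prop :=
  ∀ r, t ≤ r → r ≤ t + ℓ → ¬ G.HistHI (playPrefix f r)

/-- Information-consistency of a strategy profile: each component is constant on
indistinguishability classes of histories. -/
def Consistent (G : GameGraph n V A B) (s : ∀ i, List V → A i) : Prop :=
  ∀ (i : Fin n) (π π' : List V),
    G.IsHistory π → G.IsHistory π' → G.Indist i π π' → s i π = s i π'

/-- A play follows a strategy profile. -/
def Follows (G : GameGraph n V A B) (s : ∀ i, List V → A i) (f : ℕ → V) : Prop :=
  f 0 = G.init ∧ ∀ t, ∃ a, G.move (f t) a (f (t + 1)) ∧ ∀ i, a i = s i (playPrefix f t)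

/-- A distributed winning strategy for winning condition `W`: an information-consistent
profile all of whose outcomes lie in `W`. -/
def WinningProfile (G : GameGraph n V A B) (W : Set (ℕ → V)) (s : ∀ i, List V → A i) : Prop :=
  G.Consistent s ∧ ∀ f, G.Follows s f → f ∈ W

/-- A finite-state strategy for player `i`: implemented by a Moore machine reading
the observation sequence of the history. -/
def FinStateStrategy (G : GameGraph n V A B) (i : Fin n) (si : List V → A i) : Prop :=
  ∃ mc : Moore (B i) (A i), ∀ π, G.IsHistory π → si π = mc.output (G.obsSeq i π)

/-- The game admits a distributed winning strategy for `W`. -/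
def HasDWS (G : GameGraph n V A B) (W : Set (ℕ → V)) : Prop :=
  ∃ s : ∀ i, List V → A i, G.WinningProfile W s

/-- The game admits a finite-state distributed winning strategy for `W`. -/
def HasFinDWS (G : GameGraph n V A B) (W : Set (ℕ → V)) : Prop :=
  ∃ s : ∀ i, List V → A i, G.WinningProfile W s ∧ ∀ i, G.FinStateStrategy i (s i)

/-- `i ⪯_π j` : at history `π`, player `i` is at least as informed as player `j`. -/
def infoLE (G : GameGraph n V A B) (π : List V) (i j : Fin n) : Prop :=
  G.InfoSet i π ⊆ G.InfoSet j π

/-- The information rank of player `i` at history `π`: the number of players `j`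
with `j ≺_π i`, or with `j < i` and `j ≈_π i`. -/
noncomputable def rank (G : GameGraph n V A B) (i : Fin n) (π : List V) : ℕ :=
  Nat.card {j : Fin n //
    (G.infoLE π j i ∧ ¬ G.infoLE π i j) ∨ (j < i ∧ G.infoLE π j i ∧ G.infoLE π i j)}

/-- The signal `λ_j^i`: the set of observations of player `i` at the last positions of
histories in the information set of player `j`. -/
def lam (G : GameGraph n V A B) (i j : Fin n) (π : List V) : Set (B i) :=
  { b | ∃ π', π' ∈ G.InfoSet j π ∧ ∃ v, π'.getLast? = some v ∧ G.obs i v = b }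

/-- Players `i` and `j` cross at stage `ℓ` of the play `f`. -/
def Crossing (G : GameGraph n V A B) (f : ℕ → V) (ℓ : ℕ) (i j : Fin n) : Prop :=
  G.InfoSet i (playPrefix f ℓ) ⊂ G.InfoSet j (playPrefix f ℓ) ∧
  G.InfoSet j (playPrefix f (ℓ + 1)) ⊂ G.InfoSet i (playPrefix f (ℓ + 1))

/-- A game is cross-free if no two players cross at any stage of any play. -/
def CrossFree (G : GameGraph n V A B) : Prop :=
  ∀ f, G.IsPlay f → ∀ (ℓ : ℕ) (i j : Fin n), ¬ G.Crossing f ℓ i j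

end GameGraph

namespace GameGraph

section Histories

variable {n : ℕ} {V : Type} {A B : Fin n → Type} (G : GameGraph n V A B)

theorem IsHistory.ne_nil {G : GameGraph n V A B} {π : List V} (h : G.IsHistory π) : π ≠ [] := by
  rintro rfl
  simp [IsHistory] at h

theorem isHistory_init : G.IsHistory [G.init] :=
  ⟨rfl, List.isChain_singleton _⟩

theorem IsHistory.snoc {G : GameGraph n V A B} {π : List V} {v w : V} (h : G.IsHistory π)
    (hv : π.getLast? = some v) (hs : G.step v w) : G.IsHistory (π ++ [w]) := by
  refine ⟨?_, ?_⟩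
  · rw [List.head?_append_of_ne_nil _ h.ne_nil]
    exact h.1
  · refine List.isChain_append.2 ⟨h.2, by simp, ?_⟩
    intro x hx y hy
    simp only [Option.mem_def, List.head?_cons, Option.some.injEq] at hx hy
    rw [hv, Option.some.injEq] at hx
    exact hx ▸ hy ▸ hs

/-- A history is either initial or extends a shorter history by one move. -/
theorem IsHistory.cases {G : GameGraph n V A B} {π : List V} (h : G.IsHistory π) :
    π = [G.init] ∨ ∃ ρ v w, π = ρ ++ [w] ∧ G.IsHistory ρ ∧ ρ.getLast? = some v ∧ G.step v w := by
  rcases List.eq_nil_or_concat π with rfl | ⟨ρ, w, rfl⟩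
  · exact absurd rfl h.ne_nil
  · rw [List.concat_eq_append] at h ⊢
    rcases eq_or_ne ρ [] with rfl | hρ
    · left
      have := h.1
      simpa using this
    · right
      have hc := List.isChain_append.1 h.2
      have h1 := h.1
      rw [List.head?_append_of_ne_nil _ hρ] at h1
      refine ⟨ρ, ρ.getLast hρ, w, rfl, ⟨h1, hc.1⟩, List.getLast?_eq_some_getLast hρ, ?_⟩
      exact hc.2.2 _ (List.getLast?_eq_some_getLast hρ) _ rfl

/-- Induction along the moves of a history. -/
@[elab_as_elim]
theorem IsHistory.induct {G : GameGraph n V A B} {P : List V → Prop} (h0 : P [G.init])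
    (h1 : ∀ π v w, G.IsHistory π → π.getLast? = some v → G.step v w → P π → P (π ++ [w]))
    {π : List V} (h : G.IsHistory π) : P π := by
  induction hl : π.length generalizing π with
  | zero => exact absurd (List.length_eq_zero_iff.1 hl) h.ne_nil
  | succ k ih =>
    rcases h.cases with rfl | ⟨ρ, v, w, rfl, hρ, hv, hs⟩
    · exact h0
    · exact h1 ρ v w hρ hv hs (ih hρ (by simpa using hl))

theorem drop_one_snoc {α : Type} {π : List α} (h : π ≠ []) (w : α) :
    (π ++ [w]).drop 1 = π.drop 1 ++ [w] := by
  cases π with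
  | nil => exact absurd rfl h
  | cons a l => simp

theorem obsSeq_snoc {π : List V} (h : π ≠ []) (w : V) (i : Fin n) :
    G.obsSeq i (π ++ [w]) = G.obsSeq i π ++ [G.obs i w] := by
  simp [obsSeq, drop_one_snoc h]

theorem indist_snoc {π π' : List V} (h : π ≠ []) (h' : π' ≠ []) (w w' : V) (i : Fin n) :
    G.Indist i (π ++ [w]) (π' ++ [w']) ↔ G.Indist i π π' ∧ G.obs i w = G.obs i w' := by
  unfold Indist
  rw [G.obsSeq_snoc h, G.obsSeq_snoc h', ← List.concat_eq_append, ← List.concat_eq_append,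
    List.concat_inj]

theorem Indist.length_eq {G : GameGraph n V A B} {π π' : List V} {i : Fin n}
    (h : G.Indist i π π') (hπ : G.IsHistory π) (hπ' : G.IsHistory π') :
    π.length = π'.length := by
  have := congrArg List.length h
  have h1 := List.length_pos_iff.2 hπ.ne_nil
  have h2 := List.length_pos_iff.2 hπ'.ne_nil
  simp [obsSeq] at this
  omega

theorem playPrefix_succ (f : ℕ → V) (t : ℕ) :
    playPrefix f (t + 1) = playPrefix f t ++ [f (t + 1)] := by
  simp [playPrefix, List.range_succ]

theorem getLast?_playPrefix (f : ℕ → V) (t : ℕ) : (playPrefix f t).getLast? = some (f t) := by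
  simp [playPrefix, List.range_succ]

theorem Follows.isHistory {G : GameGraph n V A B} {s : ∀ i, List V → A i} {f : ℕ → V}
    (h : G.Follows s f) (t : ℕ) : G.IsHistory (playPrefix f t) := by
  induction t with
  | zero => simpa [playPrefix, h.1] using G.isHistory_init
  | succ t ih =>
    rw [playPrefix_succ]
    obtain ⟨a, ha, -⟩ := h.2 t
    exact ih.snoc (getLast?_playPrefix f t) ⟨a, ha⟩

/-- The positions and memory states of `M` that player `i` considers possible, updated
along the observations of `i`. -/
noncomputable def subsetMachine [Finite V] (i : Fin n) (M : Moore V (A i)) (a : A i) :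
    Moore (B i) (A i) where
  Q := Set (V × M.Q)
  finQ := by
    haveI := M.finQ
    exact Fintype.ofFinite _
  q0 := {(G.init, M.q0)}
  δ S b := {p | ∃ v q, (v, q) ∈ S ∧ G.step v p.1 ∧ G.obs i p.1 = b ∧ p.2 = M.δ q p.1}
  out S := by
    classical exact if h : S.Nonempty then M.out h.some.2 else a

theorem mem_subsetMachine_run [Finite V] (i : Fin n) (M : Moore V (A i)) (a : A i)
    {π : List V} (hπ : G.IsHistory π) (v : V) (q : M.Q) :
    ((v, q) : V × M.Q) ∈ ((G.obsSeq i π).foldl (G.subsetMachine i M a).δ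
        (G.subsetMachine i M a).q0 : Set (V × M.Q)) ↔
      ∃ π', G.IsHistory π' ∧ G.Indist i π π' ∧ π'.getLast? = some v ∧
        (π'.drop 1).foldl M.δ M.q0 = q := by
  revert v q
  refine IsHistory.induct ?_ ?_ hπ
  · intro v q
    constructor
    · intro h
      have h' : (v, q) = (G.init, M.q0) := h
      rw [Prod.mk.injEq] at h'
      refine ⟨[G.init], G.isHistory_init, rfl, ?_, ?_⟩
      · simp [h'.1]
      · simp [h'.2]
    · rintro ⟨π', h', hi, hv, hq⟩
      have hl := hi.length_eq G.isHistory_init h'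
      rcases h'.cases with rfl | ⟨ρ, u, w, rfl, hρ, -⟩
      · simp only [List.getLast?_singleton, Option.some.injEq] at hv
        simp only [List.drop_one, List.tail_cons, List.foldl_nil] at hq
        subst hv hq
        exact Set.mem_singleton _
      · exact absurd (by simpa using hl) hρ.ne_nil
  · intro π u w hπ hu hs ih v q
    erw [G.obsSeq_snoc hπ.ne_nil, List.foldl_append]
    constructor
    · rintro ⟨v', q', hm, hst, ho, hq⟩
      obtain ⟨ρ, hρ, hi, hv', hq'⟩ := (ih v' q').1 hm
      refine ⟨ρ ++ [v], hρ.snoc hv' hst, (G.indist_snoc hπ.ne_nil hρ.ne_nil _ _ _).2 ⟨hi, ho.symm⟩,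
        by simp, ?_⟩
      rw [drop_one_snoc hρ.ne_nil, List.foldl_append, hq', List.foldl_cons, List.foldl_nil]
      exact hq.symm
    · rintro ⟨π', h', hi, hv, hq⟩
      have hl := hi.length_eq (hπ.snoc hu hs) h'
      rcases h'.cases with rfl | ⟨ρ, v', w', rfl, hρ, hv', hst⟩
      · exact absurd (by simpa using hl) hπ.ne_nil
      · rw [List.getLast?_append_cons, List.getLast?_singleton, Option.some.injEq] at hv
        subst hv
        rw [G.indist_snoc hπ.ne_nil hρ.ne_nil] at hi
        rw [drop_one_snoc hρ.ne_nil, List.foldl_append] at hq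
        exact ⟨v', _, (ih v' _).2 ⟨ρ, hρ, hi.1, hv', rfl⟩, hst, hi.2.symm, hq.symm⟩

/-- An information-consistent strategy computed by a finite machine reading the positions is
also computed by a finite machine reading the observations. -/
theorem finStateStrategy_of_positions [Finite V] {i : Fin n} {si : List V → A i}
    (hc : ∀ π π', G.IsHistory π → G.IsHistory π' → G.Indist i π π' → si π = si π')
    (M : Moore V (A i)) (hM : ∀ π, G.IsHistory π → si π = M.output (π.drop 1)) :
    G.FinStateStrategy i si := by
  refine ⟨G.subsetMachine i M (si []), fun π hπ => ?_⟩
  have key := G.mem_subsetMachine_run i M (si []) hπ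
  unfold Moore.output
  set S : Set (V × M.Q) := (G.obsSeq i π).foldl (G.subsetMachine i M (si [])).δ
    (G.subsetMachine i M (si [])).q0 with hS
  have hne : S.Nonempty := by
    refine ⟨(π.getLast hπ.ne_nil, (π.drop 1).foldl M.δ M.q0), (key _ _).2 ⟨π, hπ, rfl, ?_, rfl⟩⟩
    exact List.getLast?_eq_some_getLast hπ.ne_nil
  obtain ⟨π', h', hi, -, hq⟩ := (key hne.some.1 hne.some.2).1 hne.some_mem
  have hout : (G.subsetMachine i M (si [])).out S = M.out hne.some.2 := dif_pos hne
  refine Eq.trans ?_ hout.symm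
  rw [hc π π' hπ h' hi, hM π' h', ← hq]
  rfl

end Histories

section Chain

open scoped Classical in
/-- In a chain of `n` sets, at least `m` of them contain every point covered at least `m`
times. -/
theorem le_card_superset {n m : ℕ} {X : Type} (P : Fin n → Set X)
    (hP : ∀ i j, P i ⊆ P j ∨ P j ⊆ P i) (hm : m ≤ n) :
    m ≤ (Finset.univ.filter fun j =>
      ∀ x, m ≤ (Finset.univ.filter fun k => x ∈ P k).card → x ∈ P j).card := by
  set J := Finset.univ.filter fun j =>
      ∀ x, m ≤ (Finset.univ.filter fun k => x ∈ P k).card → x ∈ P j with hJ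
  by_contra hlt
  have hne : Jᶜ.Nonempty := by
    rw [← Finset.card_pos, Finset.card_compl, Fintype.card_fin]
    omega
  obtain ⟨j, hj⟩ := Jᶜ.exists_maximalFor P hne
  have hjJ := hj.1
  simp only [hJ, Finset.mem_compl, Finset.mem_filter, Finset.mem_univ, true_and, not_forall]
    at hjJ
  obtain ⟨x, hx, hxj⟩ := hjJ
  refine hlt (hx.trans (Finset.card_le_card fun k hk => ?_))
  by_contra hkJ
  refine hxj ?_
  rw [Finset.mem_filter] at hk
  rcases hP j k with h | h
  · exact hj.2 (Finset.mem_compl.2 hkJ) h hk.2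
  · exact h hk.2

open scoped Classical in
/-- In a chain of `n` sets, more than `n - m` of them consist of points covered at least `m`
times. -/
theorem lt_card_subset {n m : ℕ} {X : Type} (P : Fin n → Set X)
    (hP : ∀ i j, P i ⊆ P j ∨ P j ⊆ P i) (hm : 0 < m) :
    n < m + (Finset.univ.filter fun j =>
      ∀ x ∈ P j, m ≤ (Finset.univ.filter fun k => x ∈ P k).card).card := by
  set J := Finset.univ.filter fun j =>
      ∀ x ∈ P j, m ≤ (Finset.univ.filter fun k => x ∈ P k).card with hJ
  by_contra hlt
  have hcard : m ≤ Jᶜ.card := by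
    rw [Finset.card_compl, Fintype.card_fin]
    omega
  obtain ⟨j, hj⟩ := Jᶜ.exists_minimalFor P (Finset.card_pos.1 (hm.trans_le hcard))
  have hjJ := hj.1
  simp only [hJ, Finset.mem_compl, Finset.mem_filter, Finset.mem_univ, true_and, not_forall]
    at hjJ
  obtain ⟨x, hxj, hx⟩ := hjJ
  refine hx (hcard.trans (Finset.card_le_card fun k hk => ?_))
  rw [Finset.mem_filter]
  refine ⟨Finset.mem_univ _, ?_⟩
  rcases hP j k with h | h
  · exact h hxj
  · exact hj.2 hk h hxj

end Chain

section Confusion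

variable {n : ℕ} {V : Type} {A B : Fin n → Type} (G : GameGraph n V A B)

open scoped Classical in
/-- The players that cannot distinguish two histories. -/
noncomputable def confused (π π' : List V) : Finset (Fin n) :=
  Finset.univ.filter fun j => G.Indist j π π'

theorem mem_confused {π π' : List V} {j : Fin n} :
    j ∈ G.confused π π' ↔ G.Indist j π π' := by
  simp [confused]

/-- At least `m` players cannot distinguish the two histories. -/
def ManyConfused (m : ℕ) (π π' : List V) : Prop := m ≤ (G.confused π π').card

variable {G}

theorem ManyConfused.symm {m : ℕ} {π π' : List V} (h : G.ManyConfused m π π') :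
    G.ManyConfused m π' π := by
  refine le_trans h (Finset.card_le_card fun j hj => ?_)
  rw [mem_confused] at hj ⊢
  exact Eq.symm hj

theorem ManyConfused.exists_indist {m : ℕ} {π π' : List V} (h : G.ManyConfused m π π')
    (hm : 0 < m) : ∃ j, G.Indist j π π' := by
  obtain ⟨j, hj⟩ := Finset.card_pos.1 (hm.trans_le h)
  exact ⟨j, G.mem_confused.1 hj⟩

theorem manyConfused_refl {m : ℕ} (hm : m ≤ n) (π : List V) : G.ManyConfused m π π := by
  have : G.confused π π = Finset.univ := by
    ext j
    simp [mem_confused, Indist]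
  simpa [ManyConfused, this] using hm

theorem ManyConfused.of_snoc {m : ℕ} {π π' : List V} {w w' : V} (hπ : π ≠ []) (hπ' : π' ≠ [])
    (h : G.ManyConfused m (π ++ [w]) (π' ++ [w'])) : G.ManyConfused m π π' := by
  refine le_trans h (Finset.card_le_card fun j hj => ?_)
  rw [mem_confused] at hj ⊢
  exact ((G.indist_snoc hπ hπ' _ _ _).1 hj).1

theorem HistHI.le_card {m : ℕ} {π : List V} (h : G.HistHI π) (hm : m ≤ n) :
    ∃ J : Finset (Fin n), m ≤ J.card ∧
      ∀ j ∈ J, ∀ ρ, G.IsHistory ρ → G.ManyConfused m π ρ → G.Indist j π ρ := by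
  classical
  refine ⟨_, le_card_superset (X := {ρ // G.IsHistory ρ}) (m := m)
    (fun j => {ρ | G.Indist j π ρ.1}) ?_ hm, ?_⟩
  · intro i j
    exact (h i j).imp (fun h ρ hρ => (h ⟨ρ.2, hρ⟩).2) (fun h ρ hρ => (h ⟨ρ.2, hρ⟩).2)
  · intro j hj ρ hρ hc
    rw [Finset.mem_filter] at hj
    refine hj.2 ⟨ρ, hρ⟩ (hc.trans (le_of_eq ?_))
    simp [confused]

theorem HistHI.lt_card {m : ℕ} {π : List V} (h : G.HistHI π) (hm : 0 < m) :
    ∃ J : Finset (Fin n), n < m + J.card ∧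
      ∀ j ∈ J, ∀ ρ, G.IsHistory ρ → G.Indist j π ρ → G.ManyConfused m π ρ := by
  classical
  refine ⟨_, lt_card_subset (X := {ρ // G.IsHistory ρ}) (m := m)
    (fun j => {ρ | G.Indist j π ρ.1}) ?_ hm, ?_⟩
  · intro i j
    exact (h i j).imp (fun h ρ hρ => (h ⟨ρ.2, hρ⟩).2) (fun h ρ hρ => (h ⟨ρ.2, hρ⟩).2)
  · intro j hj ρ hρ hc
    rw [Finset.mem_filter] at hj
    refine (hj.2 ⟨ρ, hρ⟩ hc).trans (le_of_eq ?_)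
    simp [confused]

theorem ManyConfused.trans {m : ℕ} {π₁ π₂ π₃ : List V} (h : G.HistHI π₂) (hm : m ≤ n)
    (h₁ : G.IsHistory π₁) (h₃ : G.IsHistory π₃) (h₁₂ : G.ManyConfused m π₁ π₂)
    (h₂₃ : G.ManyConfused m π₂ π₃) : G.ManyConfused m π₁ π₃ := by
  obtain ⟨J, hJ, hJ'⟩ := h.le_card hm
  refine hJ.trans (Finset.card_le_card fun j hj => ?_)
  rw [mem_confused]
  exact (hJ' j hj π₁ h₁ h₁₂.symm).symm.trans (hJ' j hj π₃ h₃ h₂₃)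

/-- Some player is, before a move, at most as informed as the `m`-fold confusion class, and
at least as informed after the move. -/
theorem exists_overtaking {m : ℕ} {π π' : List V} (h : G.HistHI π) (h' : G.HistHI π')
    (hm : 0 < m) (hmn : m ≤ n) :
    ∃ j, (∀ ρ, G.IsHistory ρ → G.ManyConfused m π ρ → G.Indist j π ρ) ∧
      ∀ ρ, G.IsHistory ρ → G.Indist j π' ρ → G.ManyConfused m π' ρ := by
  obtain ⟨J, hJ, hJ'⟩ := h.le_card hmn
  obtain ⟨L, hL, hL'⟩ := h'.lt_card hm
  have : ¬ Disjoint J L := by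
    intro hd
    have := Finset.card_le_univ (J ∪ L)
    rw [Finset.card_union_of_disjoint hd, Fintype.card_fin] at this
    omega
  obtain ⟨j, hj, hjL⟩ := Finset.not_disjoint_iff.1 this
  exact ⟨j, hJ' j hj, hL' j hjL⟩

end Confusion

section Knowledge

variable {n : ℕ} {V : Type} {A B : Fin n → Type} (G : GameGraph n V A B)

open scoped Classical in
/-- Update of the common uncertainty `K` (possible last positions, tagged with the players
that hold them possible) when the play moves to `w`. -/
def updateKnow (K : Set (V × Finset (Fin n))) (w : V) : Set (V × Finset (Fin n)) :=
  {p | ∃ u T, (u, T) ∈ K ∧ G.step u p.1 ∧ p.2 = T.filter fun j => G.obs j w = G.obs j p.1}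

/-- The last positions of the histories as long as `π`, each tagged with the set of players
that cannot distinguish it from `π`. -/
def know (π : List V) : Set (V × Finset (Fin n)) :=
  (π.drop 1).foldl G.updateKnow {(G.init, Finset.univ)}

theorem know_snoc {π : List V} (h : π ≠ []) (w : V) :
    G.know (π ++ [w]) = G.updateKnow (G.know π) w := by
  simp [know, drop_one_snoc h, List.foldl_append]

theorem mem_know {π : List V} (hπ : G.IsHistory π) (u : V) (T : Finset (Fin n)) :
    (u, T) ∈ G.know π ↔ ∃ ρ, G.IsHistory ρ ∧ ρ.length = π.length ∧ ρ.getLast? = some u ∧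
      T = G.confused π ρ := by
  revert u T
  refine IsHistory.induct ?_ ?_ hπ
  · intro u T
    have h0 : G.confused [G.init] [G.init] = Finset.univ := by
      ext j
      simp [mem_confused, Indist]
    constructor
    · intro h
      have h' : (u, T) = (G.init, Finset.univ) := h
      rw [Prod.mk.injEq] at h'
      exact ⟨[G.init], G.isHistory_init, rfl, by simp [h'.1], by rw [h0, h'.2]⟩
    · rintro ⟨ρ, hρ, hl, hu, hT⟩
      rcases hρ.cases with rfl | ⟨σ, v, w, rfl, hσ, -⟩
      · simp only [List.getLast?_singleton, Option.some.injEq] at hu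
        rw [h0] at hT
        subst hu hT
        exact Set.mem_singleton _
      · exact absurd (by simpa using hl) hσ.ne_nil
  · intro π v w hπ hv hs ih u T
    rw [G.know_snoc hπ.ne_nil]
    have hc : ∀ {ρ : List V} {x : V}, ρ ≠ [] → G.confused (π ++ [w]) (ρ ++ [x]) =
        by classical exact (G.confused π ρ).filter fun j => G.obs j w = G.obs j x := by
      intro ρ x hρ
      ext j
      simp [mem_confused, G.indist_snoc hπ.ne_nil hρ]
    constructor
    · rintro ⟨v', T', hm, hst, hT⟩
      obtain ⟨ρ, hρ, hl, hv', hT'⟩ := (ih v' T').1 hm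
      refine ⟨ρ ++ [u], hρ.snoc hv' hst, by simp [hl], by simp, ?_⟩
      rw [hc hρ.ne_nil, ← hT']
      exact hT
    · rintro ⟨ρ, hρ, hl, hu, hT⟩
      rcases hρ.cases with rfl | ⟨σ, v', w', rfl, hσ, hv', hst⟩
      · exact absurd (by simpa using hl) hπ.ne_nil
      · rw [List.getLast?_append_cons, List.getLast?_singleton, Option.some.injEq] at hu
        subst hu
        rw [hc hσ.ne_nil] at hT
        exact ⟨v', _, (ih v' _).2 ⟨σ, hσ, by simpa using hl, hv', rfl⟩, hst, hT⟩

open scoped Classical in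
/-- The level of player `i`: one less than the number of players at most as informed as `i`. -/
noncomputable def level (K : Set (V × Finset (Fin n))) (i : Fin n) : Fin n :=
  ⟨(Finset.univ.filter fun j => ∀ p ∈ K, i ∈ p.2 → j ∈ p.2).card - 1, by
    have h1 := Finset.card_le_univ (Finset.univ.filter fun j => ∀ p ∈ K, i ∈ p.2 → j ∈ p.2)
    have h2 := i.pos
    rw [Fintype.card_fin] at h1
    omega⟩

theorem know_forall_iff {π : List V} (hπ : G.IsHistory π) (i j : Fin n) :
    (∀ p ∈ G.know π, i ∈ p.2 → j ∈ p.2) ↔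
      ∀ ρ, G.IsHistory ρ → G.Indist i π ρ → G.Indist j π ρ := by
  constructor
  · intro h ρ hρ hi
    have := h (ρ.getLast hρ.ne_nil, G.confused π ρ) ((G.mem_know hπ _ _).2
      ⟨ρ, hρ, (hi.length_eq hπ hρ).symm, List.getLast?_eq_some_getLast hρ.ne_nil, rfl⟩)
      (G.mem_confused.2 hi)
    exact G.mem_confused.1 this
  · rintro h ⟨u, T⟩ hp hi
    obtain ⟨ρ, hρ, -, -, rfl⟩ := (G.mem_know hπ _ _).1 hp
    exact G.mem_confused.2 (h ρ hρ (G.mem_confused.1 hi))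

theorem level_congr {π ρ : List V} (hπ : G.IsHistory π) (hρ : G.IsHistory ρ) {i : Fin n}
    (h : G.Indist i π ρ) : level (G.know π) i = level (G.know ρ) i := by
  have : ∀ j, (∀ p ∈ G.know π, i ∈ p.2 → j ∈ p.2) ↔ ∀ p ∈ G.know ρ, i ∈ p.2 → j ∈ p.2 := by
    intro j
    rw [G.know_forall_iff hπ, G.know_forall_iff hρ]
    constructor
    · intro hj σ hσ hi
      exact (hj ρ hρ h).symm.trans (hj σ hσ (h.trans hi))
    · intro hj σ hσ hi
      exact (hj π hπ h.symm).symm.trans (hj σ hσ (h.symm.trans hi))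
  simp only [level, Fin.mk.injEq]
  congr 2
  ext j
  simp only [Finset.mem_filter, this j]

/-- The confusion class at the level of a player is the information set of that player. -/
theorem manyConfused_level_iff {π ρ : List V} (hG : G.HistHI π) (hπ : G.IsHistory π)
    (hρ : G.IsHistory ρ) (i : Fin n) :
    G.ManyConfused (level (G.know π) i + 1) π ρ ↔ G.Indist i π ρ := by
  classical
  set J : Finset (Fin n) :=
    Finset.univ.filter fun j => ∀ p ∈ G.know π, i ∈ p.2 → j ∈ p.2 with hJ
  have hiJ : i ∈ J := by simp [hJ]
  have hlev : (level (G.know π) i : ℕ) + 1 = J.card := by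
    have h1 := Finset.card_pos.2 ⟨i, hiJ⟩
    have h2 : (level (G.know π) i : ℕ) = J.card - 1 := by
      simp only [level, hJ]
    omega
  have hmem : ∀ j, j ∈ J ↔ ∀ ρ, G.IsHistory ρ → G.Indist i π ρ → G.Indist j π ρ := by
    intro j
    rw [← G.know_forall_iff hπ]
    simp [hJ]
  rw [hlev]
  constructor
  · intro h
    by_contra hi
    have hsub : G.confused π ρ ⊆ J.erase i := by
      intro j hj
      rw [mem_confused] at hj
      refine Finset.mem_erase.2 ⟨fun e => hi (e ▸ hj), (hmem j).2 ?_⟩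
      rcases hG i j with hij | hji
      · exact fun σ hσ hs => (hij ⟨hσ, hs⟩).2
      · exact absurd (hji ⟨hρ, hj⟩).2 hi
    have h1 := Finset.card_le_card hsub
    have h2 := Finset.card_erase_lt_of_mem hiJ
    unfold ManyConfused at h
    omega
  · intro h
    refine Finset.card_le_card fun j hj => ?_
    exact G.mem_confused.2 ((hmem j).1 hj ρ hρ h)

end Knowledge

section LevelGame

variable {n : ℕ} {V : Type} {A B : Fin n → Type} (G : GameGraph n V A B)

/-- The game in which player `r` has the information shared by `r + 1` players of `G`, and
chooses the actions of all players of `G` that are currently at level `r`. -/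
noncomputable def levelGame :
    GameGraph n (V × Set (V × Finset (Fin n))) (fun _ => ∀ i, A i) (fun _ => Set V) where
  init := (G.init, {(G.init, Finset.univ)})
  move x a y := y.2 = G.updateKnow x.2 y.1 ∧ G.move x.1 (fun i => a (level x.2 i) i) y.1
  noDeadEnd x a := by
    obtain ⟨w, hw⟩ := G.noDeadEnd x.1 (fun i => a (level x.2 i) i)
    exact ⟨(w, G.updateKnow x.2 w), rfl, hw⟩
  obs r x := {u | ∃ T, (u, T) ∈ x.2 ∧ (r : ℕ) + 1 ≤ T.card}

theorem levelGame_step_iff (x y : V × Set (V × Finset (Fin n))) :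
    G.levelGame.step x y ↔ G.step x.1 y.1 ∧ y.2 = G.updateKnow x.2 y.1 := by
  constructor
  · rintro ⟨a, h1, h2⟩
    exact ⟨⟨_, h2⟩, h1⟩
  · rintro ⟨⟨a, h2⟩, h1⟩
    exact ⟨fun _ => a, h1, h2⟩

variable {G}

theorem IsHistory.of_levelGame {h : List (V × Set (V × Finset (Fin n)))}
    (hh : G.levelGame.IsHistory h) :
    G.IsHistory (h.map Prod.fst) ∧ ∀ x, h.getLast? = some x →
      (h.map Prod.fst).getLast? = some x.1 ∧ x.2 = G.know (h.map Prod.fst) := by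
  refine IsHistory.induct ?_ ?_ hh
  · refine ⟨G.isHistory_init, ?_⟩
    rintro x hx
    simp only [List.getLast?_singleton, Option.some.injEq] at hx
    subst hx
    exact ⟨rfl, rfl⟩
  · rintro h x y hh hx hs ⟨ih, ihx⟩
    rw [levelGame_step_iff] at hs
    obtain ⟨hx1, hx2⟩ := ihx x hx
    rw [List.map_append, List.map_singleton]
    refine ⟨ih.snoc hx1 hs.1, ?_⟩
    intro z hz
    rw [List.getLast?_append_cons, List.getLast?_singleton, Option.some.injEq] at hz
    subst hz
    refine ⟨by simp, ?_⟩
    rw [G.know_snoc ih.ne_nil, ← hx2]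
    exact hs.2

theorem exists_levelGame_history {π : List V} (hπ : G.IsHistory π) :
    ∃ h, G.levelGame.IsHistory h ∧ h.map Prod.fst = π := by
  refine IsHistory.induct ?_ ?_ hπ
  · exact ⟨_, G.levelGame.isHistory_init, rfl⟩
  · rintro π v w hπ hv hs ⟨h, hh, rfl⟩
    have hx := List.getLast?_eq_some_getLast hh.ne_nil
    obtain ⟨hx1, -⟩ := hh.of_levelGame.2 _ hx
    rw [hv, Option.some.injEq] at hx1
    refine ⟨h ++ [(w, G.updateKnow (h.getLast hh.ne_nil).2 w)], hh.snoc hx ?_, by simp⟩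
    rw [levelGame_step_iff]
    exact ⟨hx1 ▸ hs, rfl⟩

theorem levelGame_history_unique {h h' : List (V × Set (V × Finset (Fin n)))}
    (hh : G.levelGame.IsHistory h) (hh' : G.levelGame.IsHistory h')
    (he : h.map Prod.fst = h'.map Prod.fst) : h = h' := by
  suffices H : ∀ h', G.levelGame.IsHistory h' → h.map Prod.fst = h'.map Prod.fst → h = h' from
    H h' hh' he
  clear he hh' h'
  refine IsHistory.induct ?_ ?_ hh
  · intro h' hh' he
    have hl := congrArg List.length he
    rcases hh'.cases with rfl | ⟨ρ, v, w, rfl, hρ, -⟩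
    · rfl
    · exact absurd (by simpa using hl) hρ.ne_nil
  · intro h x y hh hx hs ih h' hh' he
    have hl := congrArg List.length he
    rcases hh'.cases with rfl | ⟨ρ, x', y', rfl, hρ, hx', hs'⟩
    · exact absurd (by simpa using hl) hh.ne_nil
    · rw [List.map_append, List.map_append, List.map_singleton, List.map_singleton,
        ← List.concat_eq_append, ← List.concat_eq_append, List.concat_inj] at he
      obtain rfl := ih ρ hρ he.1
      rw [hx, Option.some.injEq] at hx'
      subst hx'
      rw [levelGame_step_iff] at hs hs'
      have : y = y' := Prod.ext he.2 (by rw [hs.2, hs'.2, he.2])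
      rw [this]

theorem mem_levelGame_obs {h : List (V × Set (V × Finset (Fin n)))}
    (hh : G.levelGame.IsHistory h) {x : V × Set (V × Finset (Fin n))}
    (hx : h.getLast? = some x) (r : Fin n) (u : V) :
    u ∈ G.levelGame.obs r x ↔ ∃ ρ, G.IsHistory ρ ∧ ρ.getLast? = some u ∧
      G.ManyConfused (r + 1) (h.map Prod.fst) ρ := by
  obtain ⟨hπ, hk⟩ := hh.of_levelGame
  obtain ⟨-, hk⟩ := hk x hx
  change (∃ T, (u, T) ∈ x.2 ∧ (r : ℕ) + 1 ≤ T.card) ↔ _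
  rw [hk]
  constructor
  · rintro ⟨T, hT, hc⟩
    obtain ⟨ρ, hρ, -, hu, rfl⟩ := (G.mem_know hπ _ _).1 hT
    exact ⟨ρ, hρ, hu, hc⟩
  · rintro ⟨ρ, hρ, hu, hc⟩
    obtain ⟨j, hj⟩ := hc.exists_indist (Nat.succ_pos _)
    exact ⟨_, (G.mem_know hπ _ _).2 ⟨ρ, hρ, (hj.length_eq hπ hρ).symm, hu, rfl⟩, hc⟩

/-- Player `r` of the level game confuses two histories exactly if `r + 1` players of `G` do. -/
theorem levelGame_indist_iff (hG : G.DynamicHI) (r : Fin n)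
    {h h' : List (V × Set (V × Finset (Fin n)))}
    (hh : G.levelGame.IsHistory h) (hh' : G.levelGame.IsHistory h') :
    G.levelGame.Indist r h h' ↔
      G.ManyConfused (r + 1) (h.map Prod.fst) (h'.map Prod.fst) := by
  revert h'
  have hrn : (r : ℕ) + 1 ≤ n := r.2
  have hr0 : 0 < (r : ℕ) + 1 := Nat.succ_pos _
  have hlen : ∀ {h h' : List (V × Set (V × Finset (Fin n)))}, G.levelGame.IsHistory h →
      G.levelGame.IsHistory h' → (G.levelGame.Indist r h h' ∨
      G.ManyConfused (r + 1) (h.map Prod.fst) (h'.map Prod.fst)) → h.length = h'.length := by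
    intro h h' hh hh' hor
    rcases hor with hor | hor
    · exact hor.length_eq hh hh'
    · obtain ⟨j, hj⟩ := hor.exists_indist hr0
      simpa using hj.length_eq hh.of_levelGame.1 hh'.of_levelGame.1
  refine IsHistory.induct ?_ ?_ hh
  · intro h' hh'
    have hl := hlen G.levelGame.isHistory_init hh'
    rcases hh'.cases with rfl | ⟨ρ, v, w, rfl, hρ, -⟩
    · exact iff_of_true rfl (manyConfused_refl hrn _)
    · have : ¬ [G.levelGame.init].length = (ρ ++ [w]).length := by
        intro e
        exact absurd (by simpa using e) hρ.ne_nil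
      exact iff_of_false (fun e => this (hl (Or.inl e))) (fun e => this (hl (Or.inr e)))
  · intro h x y hh hx hs ih h' hh'
    have hhy := hh.snoc hx hs
    have hl := hlen hhy hh'
    rcases hh'.cases with rfl | ⟨k, x', y', rfl, hk, hx', hs'⟩
    · have : ¬ (h ++ [y]).length = [G.levelGame.init].length := by
        intro e
        exact absurd (by simpa using e) hh.ne_nil
      exact iff_of_false (fun e => this (hl (Or.inl e))) (fun e => this (hl (Or.inr e)))
    rw [G.levelGame.indist_snoc hh.ne_nil hk.ne_nil, ih hk]
    have hp := hh.of_levelGame.1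
    have hq := hk.of_levelGame.1
    have hpy := hhy.of_levelGame.1
    have hqy := hh'.of_levelGame.1
    have oy := mem_levelGame_obs (x := y) hhy (by simp) r
    have oy' := mem_levelGame_obs (x := y') hh' (by simp) r
    rw [List.map_append, List.map_singleton] at hpy hqy oy oy' ⊢
    rw [List.map_append, List.map_singleton]
    constructor
    · rintro ⟨he, ho⟩
      have hy : y.1 ∈ G.levelGame.obs r y' := by
        rw [← ho, oy]
        exact ⟨_, hpy, by simp, manyConfused_refl hrn _⟩
      obtain ⟨σ, hσ, hu, hc⟩ := (oy' _).1 hy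
      obtain ⟨j, hj, hj'⟩ := exists_overtaking (hG _ hp) (hG _ hpy) hr0 hrn
      obtain ⟨l, hl'⟩ := hc.exists_indist hr0
      have hlen' := hl'.length_eq hqy hσ
      rcases hσ.cases with rfl | ⟨ρ, v, w, rfl, hρ, hv, hst⟩
      · exact absurd (by simpa using hlen') hk.ne_nil
      · rw [List.getLast?_append_cons, List.getLast?_singleton, Option.some.injEq] at hu
        subst hu
        have h1 := he.trans (hG _ hq) hrn hp hρ (hc.of_snoc hq.ne_nil hρ.ne_nil)
        have h2 := hj' _ hσ ((G.indist_snoc hp.ne_nil hρ.ne_nil _ _ _).2 ⟨hj _ hρ h1, rfl⟩)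
        exact h2.trans (hG _ hσ) hrn hpy hqy hc.symm
    · intro hc
      refine ⟨hc.of_snoc hp.ne_nil hq.ne_nil, Set.ext fun u => ?_⟩
      rw [oy, oy']
      constructor
      · rintro ⟨σ, hσ, hu, h1⟩
        exact ⟨σ, hσ, hu, hc.symm.trans (hG _ hpy) hrn hqy hσ h1⟩
      · rintro ⟨σ, hσ, hu, h1⟩
        exact ⟨σ, hσ, hu, hc.trans (hG _ hqy) hrn hpy hσ h1⟩

theorem levelGame_infoSet_anti (hG : G.DynamicHI) {r r' : Fin n} (hr : r ≤ r')
    {h : List (V × Set (V × Finset (Fin n)))} (hh : G.levelGame.IsHistory h) :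
    G.levelGame.InfoSet r' h ⊆ G.levelGame.InfoSet r h := by
  rintro h' ⟨hh', hi⟩
  refine ⟨hh', (levelGame_indist_iff hG r hh hh').2 ?_⟩
  exact le_trans (Nat.succ_le_succ hr) ((levelGame_indist_iff hG r' hh hh').1 hi)

theorem levelGame_dynamicHI (hG : G.DynamicHI) : G.levelGame.DynamicHI := by
  intro h hh i j
  exact (le_total j i).imp (fun hij => levelGame_infoSet_anti hG hij hh)
    (fun hij => levelGame_infoSet_anti hG hij hh)

theorem levelGame_crossFree (hG : G.DynamicHI) : G.levelGame.CrossFree := by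
  rintro f hf ℓ i j ⟨h1, h2⟩
  rcases le_total i j with hij | hij
  · exact h1.2 (levelGame_infoSet_anti hG hij (hf ℓ))
  · exact h2.2 (levelGame_infoSet_anti hG hij (hf (ℓ + 1)))

open scoped Classical in
/-- The profile of the level game induced by a profile of `G`. -/
noncomputable def pushProfile (G : GameGraph n V A B) (s : ∀ i, List V → A i) (r : Fin n)
    (h : List (V × Set (V × Finset (Fin n)))) (i : Fin n) : A i :=
  if level (G.know (h.map Prod.fst)) i = r then s i (h.map Prod.fst) else s i []

theorem pushProfile_consistent (hG : G.DynamicHI) {s : ∀ i, List V → A i}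
    (hs : G.Consistent s) : G.levelGame.Consistent (G.pushProfile s) := by
  intro r h h' hh hh' hi
  have hp := hh.of_levelGame.1
  have hq := hh'.of_levelGame.1
  have hc := (levelGame_indist_iff hG r hh hh').1 hi
  funext i
  have key : ∀ {π ρ : List V}, G.IsHistory π → G.IsHistory ρ → G.ManyConfused (r + 1) π ρ →
      level (G.know π) i = r → level (G.know ρ) i = r ∧ s i π = s i ρ := by
    intro π ρ hπ hρ hc hl
    subst hl
    have := (G.manyConfused_level_iff (hG _ hπ) hπ hρ i).1 hc
    exact ⟨(G.level_congr hπ hρ this).symm, hs i _ _ hπ hρ this⟩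
  unfold pushProfile
  by_cases h1 : level (G.know (h.map Prod.fst)) i = r
  · obtain ⟨h2, h3⟩ := key hp hq hc h1
    rw [if_pos h1, if_pos h2, h3]
  · rw [if_neg h1, if_neg fun h2 => h1 (key hq hp hc.symm h2).1]

theorem Follows.of_levelGame {s : ∀ i, List V → A i}
    {f : ℕ → V × Set (V × Finset (Fin n))} (hf : G.levelGame.Follows (G.pushProfile s) f) :
    G.Follows s (fun t => (f t).1) := by
  refine ⟨congrArg Prod.fst hf.1, fun t => ?_⟩
  obtain ⟨a, ⟨-, hm⟩, ha⟩ := hf.2 t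
  refine ⟨_, hm, fun i => ?_⟩
  have hk := ((hf.isHistory t).of_levelGame.2 _ (getLast?_playPrefix f t)).2
  have hp : (playPrefix f t).map Prod.fst = playPrefix (fun t => (f t).1) t := by
    simp [playPrefix]
  rw [ha]
  simp only [pushProfile]
  rw [← hk, if_pos rfl, hp]

/-- The machine reading positions of the level game that runs all machines of the players
of `G` and keeps track of the levels. -/
noncomputable def pushMachine [Finite V] (G : GameGraph n V A B) (mc : ∀ i, Moore (B i) (A i))
    (a : ∀ i, A i) (r : Fin n) : Moore (V × Set (V × Finset (Fin n))) (∀ i, A i) where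
  Q := Set (V × Finset (Fin n)) × ∀ i, (mc i).Q
  finQ := by
    haveI := fun i => (mc i).finQ
    exact Fintype.ofFinite _
  q0 := ({(G.init, Finset.univ)}, fun i => (mc i).q0)
  δ q x := (x.2, fun i => (mc i).δ (q.2 i) (G.obs i x.1))
  out q i := by
    classical exact if level q.1 i = r then (mc i).out (q.2 i) else a i

theorem pushMachine_run [Finite V] (mc : ∀ i, Moore (B i) (A i)) (a : ∀ i, A i) (r : Fin n)
    {h : List (V × Set (V × Finset (Fin n)))} (hh : G.levelGame.IsHistory h) :
    (h.drop 1).foldl (G.pushMachine mc a r).δ (G.pushMachine mc a r).q0 =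
      (G.know (h.map Prod.fst),
        fun i => (G.obsSeq i (h.map Prod.fst)).foldl (mc i).δ (mc i).q0) := by
  refine IsHistory.induct ?_ ?_ hh
  · rfl
  · intro h x y hh hx hs ih
    have hp := hh.of_levelGame.1
    have hk := ((hh.snoc hx hs).of_levelGame.2 y (by simp)).2
    rw [drop_one_snoc hh.ne_nil, List.foldl_append, ih, ← hk, List.map_append,
      List.map_singleton]
    simp only [G.obsSeq_snoc hp.ne_nil, List.foldl_append]
    rfl

theorem pushProfile_finState [Finite V] (hG : G.DynamicHI) {s : ∀ i, List V → A i}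
    (hs : G.Consistent s) (hf : ∀ i, G.FinStateStrategy i (s i)) (r : Fin n) :
    G.levelGame.FinStateStrategy r (G.pushProfile s r) := by
  choose mc hmc using hf
  refine G.levelGame.finStateStrategy_of_positions
    (fun h h' hh hh' hi => pushProfile_consistent hG hs r h h' hh hh' hi)
    (G.pushMachine mc (fun i => s i []) r) fun h hh => ?_
  unfold Moore.output
  rw [pushMachine_run mc _ r hh]
  funext i
  simp only [pushProfile, pushMachine]
  rw [hmc i _ hh.of_levelGame.1]
  rfl

/-- The history of the level game over a history of `G`. -/
noncomputable def liftHistory (G : GameGraph n V A B) (π : List V) :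
    List (V × Set (V × Finset (Fin n))) :=
  Classical.epsilon fun h => G.levelGame.IsHistory h ∧ h.map Prod.fst = π

theorem liftHistory_spec {π : List V} (hπ : G.IsHistory π) :
    G.levelGame.IsHistory (G.liftHistory π) ∧ (G.liftHistory π).map Prod.fst = π :=
  Classical.epsilon_spec (exists_levelGame_history hπ)

theorem liftHistory_map {h : List (V × Set (V × Finset (Fin n)))}
    (hh : G.levelGame.IsHistory h) : G.liftHistory (h.map Prod.fst) = h := by
  obtain ⟨h1, h2⟩ := liftHistory_spec hh.of_levelGame.1
  exact levelGame_history_unique h1 hh h2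

/-- The profile of `G` induced by a profile of the level game. -/
noncomputable def pullProfile (G : GameGraph n V A B)
    (s : Fin n → List (V × Set (V × Finset (Fin n))) → ∀ i, A i) (i : Fin n) (π : List V) :
    A i :=
  s (level (G.know π) i) (G.liftHistory π) i

theorem pullProfile_consistent (hG : G.DynamicHI)
    {s : Fin n → List (V × Set (V × Finset (Fin n))) → ∀ i, A i}
    (hs : G.levelGame.Consistent s) : G.Consistent (G.pullProfile s) := by
  intro i π ρ hπ hρ hi
  obtain ⟨h1, h2⟩ := liftHistory_spec hπ
  obtain ⟨h3, h4⟩ := liftHistory_spec hρ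
  unfold pullProfile
  rw [← G.level_congr hπ hρ hi]
  refine congrFun (hs _ _ _ h1 h3 ((levelGame_indist_iff hG _ h1 h3).2 ?_)) i
  rw [h2, h4]
  exact (G.manyConfused_level_iff (hG _ hπ) hπ hρ i).2 hi

theorem Follows.levelGame {s : Fin n → List (V × Set (V × Finset (Fin n))) → ∀ i, A i}
    {f : ℕ → V} (hf : G.Follows (G.pullProfile s) f) :
    G.levelGame.Follows s (fun t => (f t, G.know (playPrefix f t))) := by
  set g : ℕ → V × Set (V × Finset (Fin n)) := fun t => (f t, G.know (playPrefix f t)) with hg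
  have hfst : ∀ t, (playPrefix g t).map Prod.fst = playPrefix f t := by
    intro t
    simp [playPrefix, hg]
  have hsucc : ∀ t, (g (t + 1)).2 = G.updateKnow (g t).2 (g (t + 1)).1 := by
    intro t
    simp only [hg]
    rw [playPrefix_succ, G.know_snoc (hf.isHistory t).ne_nil]
  have h0 : g 0 = G.levelGame.init := by
    simp only [hg, playPrefix, hf.1]
    rfl
  have hhist : ∀ t, G.levelGame.IsHistory (playPrefix g t) := by
    intro t
    induction t with
    | zero => simpa [playPrefix, h0] using G.levelGame.isHistory_init
    | succ t ih =>
      rw [playPrefix_succ]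
      obtain ⟨a, ha, -⟩ := hf.2 t
      exact ih.snoc (getLast?_playPrefix g t)
        ((G.levelGame_step_iff _ _).2 ⟨⟨a, ha⟩, hsucc t⟩)
  refine ⟨h0, fun t => ⟨fun r => s r (playPrefix g t), ⟨hsucc t, ?_⟩, fun _ => rfl⟩⟩
  obtain ⟨a, ha, hai⟩ := hf.2 t
  have hact : a = fun i => s (level (g t).2 i) (playPrefix g t) i := by
    funext i
    rw [hai]
    unfold pullProfile
    rw [← hfst t, liftHistory_map (hhist t), hfst t]
  exact hact ▸ ha

/-- The machine reading positions of `G` that runs all machines of the level game. -/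
noncomputable def pullMachine [Finite V] (G : GameGraph n V A B)
    (mc : Fin n → Moore (Set V) (∀ i, A i)) (i : Fin n) : Moore V (A i) where
  Q := Set (V × Finset (Fin n)) × ∀ r, (mc r).Q
  finQ := by
    haveI := fun r => (mc r).finQ
    exact Fintype.ofFinite _
  q0 := ({(G.init, Finset.univ)}, fun r => (mc r).q0)
  δ q w := (G.updateKnow q.1 w,
    fun r => (mc r).δ (q.2 r) (G.levelGame.obs r (w, G.updateKnow q.1 w)))
  out q := (mc (level q.1 i)).out (q.2 (level q.1 i)) i

theorem pullMachine_run [Finite V] (mc : Fin n → Moore (Set V) (∀ i, A i)) (i : Fin n)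
    {h : List (V × Set (V × Finset (Fin n)))} (hh : G.levelGame.IsHistory h) :
    ((h.map Prod.fst).drop 1).foldl (G.pullMachine mc i).δ (G.pullMachine mc i).q0 =
      (G.know (h.map Prod.fst),
        fun r => (G.levelGame.obsSeq r h).foldl (mc r).δ (mc r).q0) := by
  refine IsHistory.induct ?_ ?_ hh
  · rfl
  · intro h x y hh hx hs ih
    have hp := hh.of_levelGame.1
    have hk := ((hh.snoc hx hs).of_levelGame.2 y (by simp)).2
    rw [List.map_append, List.map_singleton, G.know_snoc hp.ne_nil] at hk
    rw [List.map_append, List.map_singleton, drop_one_snoc hp.ne_nil, List.foldl_append, ih,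
      G.know_snoc hp.ne_nil]
    simp only [G.levelGame.obsSeq_snoc hh.ne_nil, List.foldl_append]
    change (G.updateKnow _ _, fun r => (mc r).δ _ (G.levelGame.obs r (y.1, _))) = _
    rw [← hk]
    rfl

theorem pullProfile_finState [Finite V] (hG : G.DynamicHI)
    {s : Fin n → List (V × Set (V × Finset (Fin n))) → ∀ i, A i}
    (hs : G.levelGame.Consistent s) (hf : ∀ r, G.levelGame.FinStateStrategy r (s r))
    (i : Fin n) : G.FinStateStrategy i (G.pullProfile s i) := by
  choose mc hmc using hf
  refine G.finStateStrategy_of_positions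
    (fun π ρ hπ hρ hi => pullProfile_consistent hG hs i π ρ hπ hρ hi)
    (G.pullMachine mc i) fun π hπ => ?_
  obtain ⟨h1, h2⟩ := liftHistory_spec hπ
  have hrun := pullMachine_run mc i h1
  rw [h2] at hrun
  unfold Moore.output
  rw [hrun]
  unfold pullProfile
  rw [hmc _ _ h1]
  rfl

end LevelGame

end GameGraph

/-- The parity automaton that reads the first component of each letter. -/
def ParityAut.onFst {α : Type} (d : ParityAut α) (β : Type) : ParityAut (α × β) where
  Q := d.Q
  finQ := d.finQ
  q0 := d.q0
  δ q x := d.δ q x.1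
  prio := d.prio

theorem ParityAut.onFst_accepts {α β : Type} (d : ParityAut α) (f : ℕ → α × β) :
    (d.onFst β).Accepts f ↔ d.Accepts (fun t => (f t).1) := by
  have : ∀ t, (d.onFst β).run f t = d.run (fun t => (f t).1) t := by
    intro t
    induction t with
    | zero => rfl
    | succ t ih =>
      change d.δ ((d.onFst β).run f t) (f t).1 = _
      rw [ih]
      rfl
  unfold ParityAut.Accepts
  simp only [this]
  rfl

namespace GameGraph

variable {n : ℕ} {V : Type} {A B : Fin n → Type} {G : GameGraph n V A B}

theorem WinningProfile.push (hG : G.DynamicHI) {d : ParityAut V} {s : ∀ i, List V → A i}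
    (h : G.WinningProfile { f | d.Accepts f } s) :
    G.levelGame.WinningProfile { f | (d.onFst _).Accepts f } (G.pushProfile s) :=
  ⟨pushProfile_consistent hG h.1, fun f hf => (d.onFst_accepts f).2 (h.2 _ hf.of_levelGame)⟩

theorem WinningProfile.pull (hG : G.DynamicHI) {d : ParityAut V}
    {s : Fin n → List (V × Set (V × Finset (Fin n))) → ∀ i, A i}
    (h : G.levelGame.WinningProfile { f | (d.onFst _).Accepts f } s) :
    G.WinningProfile { f | d.Accepts f } (G.pullProfile s) :=
  ⟨pullProfile_consistent hG h.1,
    fun _ hf => (d.onFst_accepts _).1 (h.2 _ hf.levelGame)⟩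

end GameGraph

/-- Every finite game with dynamic hierarchical information and an
ω-regular winning condition (given by a deterministic parity automaton over positions) is
equivalent to a cross-free finite game with dynamic hierarchical information and an
ω-regular winning condition: the existence of (finite-state) distributed winning strategies
is preserved in both directions. -/
theorem statement11 {n : ℕ} {V : Type} {A B : Fin n → Type}
    [Fintype V] [∀ i, Fintype (A i)] [∀ i, Fintype (B i)]
    (G : GameGraph n V A B) (hG : G.DynamicHI) (d : ParityAut V) :
    ∃ (V' : Type) (_ : Fintype V') (A' B' : Fin n → Type)
      (_ : ∀ i, Fintype (A' i)) (_ : ∀ i, Fintype (B' i))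
      (G' : GameGraph n V' A' B') (d' : ParityAut V'),
      G'.DynamicHI ∧ G'.CrossFree ∧
      (G.HasDWS { f | d.Accepts f } ↔ G'.HasDWS { f | d'.Accepts f }) ∧
      (G.HasFinDWS { f | d.Accepts f } ↔ G'.HasFinDWS { f | d'.Accepts f }) := by
  classical
  refine ⟨_, Fintype.ofFinite _, _, _, fun _ => inferInstance, fun _ => Fintype.ofFinite _,
    G.levelGame, d.onFst _, GameGraph.levelGame_dynamicHI hG, GameGraph.levelGame_crossFree hG,
    ⟨?_, ?_⟩, ⟨?_, ?_⟩⟩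
  · rintro ⟨s, hs⟩
    exact ⟨_, hs.push hG⟩
  · rintro ⟨s, hs⟩
    exact ⟨_, hs.pull hG⟩
  · rintro ⟨s, hs, hf⟩
    exact ⟨_, hs.push hG, GameGraph.pushProfile_finState hG hs.1 hf⟩
  · rintro ⟨s, hs, hf⟩
    exact ⟨_, hs.pull hG, GameGraph.pullProfile_finState hG hs.1 hf⟩
end
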